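/- For every k ≥ 1, the inverse of the time-k reachable set factors as the ordered setwise product (R_k)⁻¹ = f₀^{k-1}((R_1)⁻¹) · f₀^{k-2}((R_1)⁻¹) ⋯ f₀((R_1)⁻¹) · (R_1)⁻¹, where (A)⁻¹ = {a⁻¹ : a ∈ A}, R_1 = {b(u) : u ∈ U}, and f₀^i(A) is the image of A under the i-th iterate of f₀ (for k = 1 the identity reads (R_1)⁻¹ = (R_1)⁻¹). -/

import Mathlib

open Pointwise

/-- The solution of a discrete-time linear control system:
`phi f₀ b 0 x u = x`, `phi f₀ b (k+1) x u = b (u k) * f₀ (phi f₀ b k x u)`. -/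
def phi {G : Type*} [Group G] {U : Type*} (f₀ : G ≃* G) (b : U → G) :
    ℕ → G → (ℕ → U) → G
  | 0, x, _ => x
  | k + 1, x, u => b (u k) * f₀ (phi f₀ b k x u)

/-- The reachable set from `x` at time `k`. -/
def reach {G : Type*} [Group G] {U : Type*} (f₀ : G ≃* G) (b : U → G)
    (k : ℕ) (x : G) : Set G :=
  {y | ∃ u : ℕ → U, phi f₀ b k x u = y}

theorem phi_congr {G : Type*} [Group G] {U : Type*} (f₀ : G ≃* G) (b : U → G) (x : G)
    {k : ℕ} {u v : ℕ → U} (h : ∀ i < k, u i = v i) :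
    phi f₀ b k x u = phi f₀ b k x v := by
  induction k with
  | zero => rfl
  | succ k ih =>
    simp only [phi]
    rw [h k k.lt_succ_self, ih fun i hi => h i (Nat.lt_succ_of_lt hi)]

theorem reach_zero {G : Type*} [Group G] {U : Type*} [Nonempty U] (f₀ : G ≃* G) (b : U → G)
    (x : G) : reach f₀ b 0 x = {x} := by
  ext y
  simp [reach, phi, eq_comm]

theorem reach_succ {G : Type*} [Group G] {U : Type*} (f₀ : G ≃* G) (b : U → G)
    (k : ℕ) (x : G) : reach f₀ b (k + 1) x = Set.range b * f₀ '' reach f₀ b k x := by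
  ext y
  constructor
  · rintro ⟨u, rfl⟩
    exact Set.mul_mem_mul ⟨u k, rfl⟩ ⟨_, ⟨u, rfl⟩, rfl⟩
  · rintro ⟨_, ⟨w, rfl⟩, _, ⟨_, ⟨u, rfl⟩, rfl⟩, rfl⟩
    refine ⟨Function.update u k w, ?_⟩
    simp only [phi, Function.update_self]
    rw [phi_congr f₀ b x fun i hi => Function.update_of_ne hi.ne w u]

theorem image_prod_map_iterate {G : Type*} [Group G] (f₀ : G ≃* G) (A : Set G) (l : List ℕ) :
    f₀ '' (l.map fun i => (⇑f₀)^[i] '' A).prod =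
      (l.map fun i => (⇑f₀)^[i + 1] '' A).prod := by
  induction l with
  | nil => simp [Set.singleton_one]
  | cons i l ih =>
    simp only [List.map_cons, List.prod_cons]
    rw [Set.image_mul, ih, Set.image_image]
    simp only [Function.iterate_succ_apply']

/-- for k ≥ 1,
(R_k)⁻¹ = f₀^{k-1}((R₁)⁻¹) · f₀^{k-2}((R₁)⁻¹) ⋯ f₀((R₁)⁻¹) · (R₁)⁻¹,
where R₁ = {b u : u ∈ U}. -/
theorem reach_inv_prod {G : Type*} [Group G] {U : Type*} [Zero U]
    (f₀ : G ≃* G) (b : U → G) (hb : b 0 = 1) (k : ℕ) (hk : 1 ≤ k) :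
    (reach f₀ b k 1)⁻¹ =
      ((List.range k).reverse.map fun i => (⇑f₀)^[i] '' (Set.range b)⁻¹).prod := by
  clear hk hb
  induction k with
  | zero =>
    have : Nonempty U := ⟨0⟩
    simp [reach_zero, Set.singleton_one]
  | succ k ih =>
    rw [reach_succ, mul_inv_rev, ← Set.image_inv, ih, image_prod_map_iterate,
      List.range_succ_eq_map]
    simp [List.map_reverse, Function.comp_def]
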